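/- (Proposition 1.2, bijectivity part) Fix null vectors w₀, w₃ ∈ ℂ⁴ with ⟨w₀, w₃⟩ = i. The map Q̂ : ℝ × 𝔼 → Σ_{w₃} defined by Q̂(t, z) = z + w₀ − (i/2)·⟨z, z⟩·w₃ + t·w₃ is well defined (its values lie in Σ_{w₃}) and is a bijection, with inverse given by w ↦ ( (i/2)·(⟨w, w₀⟩ − ⟨w₀, w⟩), P(w) ), where the first component (i/2)·(⟨w, w₀⟩ − ⟨w₀, w⟩) is a real number for every w ∈ Σ_{w₃}. -/

import Mathlib

open Complex ComplexConjugate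

/-- The Hermitian form of signature (3,1) on `ℂ⁴`. -/
noncomputable def herm (z w : Fin 4 → ℂ) : ℂ :=
  z 1 * conj (w 1) + z 2 * conj (w 2) + Complex.I * (z 0 * conj (w 3) - z 3 * conj (w 0))

/-- The stereographic projection `P(w) = w − w₀ − i·⟨w, w₀⟩·w₃`. -/
noncomputable def Pmap (w₀ w₃ : Fin 4 → ℂ) (w : Fin 4 → ℂ) : Fin 4 → ℂ :=
  w - w₀ - (Complex.I * herm w w₀) • w₃

/-- The map `Q̂(t, z) = z + w₀ − (i/2)·⟨z, z⟩·w₃ + t·w₃`. -/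
noncomputable def Qhat (w₀ w₃ : Fin 4 → ℂ) (t : ℝ) (z : Fin 4 → ℂ) : Fin 4 → ℂ :=
  z + w₀ - (Complex.I / 2 * herm z z) • w₃ + (t : ℂ) • w₃

lemma herm_add_left (a b c : Fin 4 → ℂ) : herm (a + b) c = herm a c + herm b c := by
  simp only [herm, Pi.add_apply]; ring

lemma herm_sub_left (a b c : Fin 4 → ℂ) : herm (a - b) c = herm a c - herm b c := by
  simp only [herm, Pi.sub_apply]; ring

lemma herm_smul_left (k : ℂ) (a c : Fin 4 → ℂ) : herm (k • a) c = k * herm a c := by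
  simp only [herm, Pi.smul_apply, smul_eq_mul]; ring

lemma herm_conj (a b : Fin 4 → ℂ) : conj (herm a b) = herm b a := by
  simp only [herm, map_add, map_mul, map_sub, Complex.conj_conj, Complex.conj_I]; ring

lemma herm_add_right (a b c : Fin 4 → ℂ) : herm c (a + b) = herm c a + herm c b := by
  simp only [herm, Pi.add_apply, map_add]; ring

lemma herm_sub_right (a b c : Fin 4 → ℂ) : herm c (a - b) = herm c a - herm c b := by
  simp only [herm, Pi.sub_apply, map_sub]; ring

lemma herm_smul_right (k : ℂ) (a c : Fin 4 → ℂ) : herm c (k • a) = conj k * herm c a := by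
  simp only [herm, Pi.smul_apply, smul_eq_mul, map_mul]; ring

/-- Proposition 1.2 (bijectivity part): `Q̂ : ℝ × 𝔼 → Σ_{w₃}` is well defined and a bijection,
with inverse `w ↦ ((i/2)·(⟨w, w₀⟩ − ⟨w₀, w⟩), P(w))`, the first component being real. -/
theorem stmt_6 (w₀ w₃ : Fin 4 → ℂ) (h₀ : herm w₀ w₀ = 0) (h₃ : herm w₃ w₃ = 0)
    (h₀₃ : herm w₀ w₃ = Complex.I) :
    -- `Q̂` is well defined: its values lie in `Σ_{w₃}`
    (∀ (t : ℝ) (z : Fin 4 → ℂ), herm z w₀ = 0 → herm z w₃ = 0 →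
      herm (Qhat w₀ w₃ t z) (Qhat w₀ w₃ t z) = 0 ∧
      herm (Qhat w₀ w₃ t z) w₃ = Complex.I) ∧
    -- the claimed inverse is a left inverse on `ℝ × 𝔼`
    (∀ (t : ℝ) (z : Fin 4 → ℂ), herm z w₀ = 0 → herm z w₃ = 0 →
      Complex.I / 2 * (herm (Qhat w₀ w₃ t z) w₀ - herm w₀ (Qhat w₀ w₃ t z)) = (t : ℂ) ∧
      Pmap w₀ w₃ (Qhat w₀ w₃ t z) = z) ∧
    -- the claimed inverse lands in `ℝ × 𝔼` and is a right inverse on `Σ_{w₃}`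
    (∀ w : Fin 4 → ℂ, herm w w = 0 → herm w w₃ = Complex.I →
      (Complex.I / 2 * (herm w w₀ - herm w₀ w)).im = 0 ∧
      herm (Pmap w₀ w₃ w) w₀ = 0 ∧ herm (Pmap w₀ w₃ w) w₃ = 0 ∧
      Qhat w₀ w₃ ((Complex.I / 2 * (herm w w₀ - herm w₀ w)).re) (Pmap w₀ w₃ w) = w) := by
  have hI : Complex.I * Complex.I = -1 := Complex.I_mul_I
  have h₃₀ : herm w₃ w₀ = -Complex.I := by rw [← herm_conj, h₀₃, Complex.conj_I]
  have h2 : conj (2 : ℂ) = 2 := Complex.conj_ofNat 2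
  refine ⟨?_, ?_, ?_⟩
  · intro t z hz0 hz3
    have h0z : herm w₀ z = 0 := by rw [← herm_conj, hz0, map_zero]
    have h3z : herm w₃ z = 0 := by rw [← herm_conj, hz3, map_zero]
    constructor
    · simp only [Qhat, herm_add_left, herm_sub_left, herm_smul_left, herm_add_right,
        herm_sub_right, herm_smul_right, h₀, h₃, h₀₃, h₃₀, hz0, hz3, h0z, h3z, map_mul, map_div₀,
        Complex.conj_I, Complex.conj_ofReal, herm_conj, h2]
      linear_combination (herm z z) * hI
    · simp only [Qhat, herm_add_left, herm_sub_left, herm_smul_left, h₃, h₀₃, hz3]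
      ring
  · intro t z hz0 hz3
    have h0z : herm w₀ z = 0 := by rw [← herm_conj, hz0, map_zero]
    have e : herm (Qhat w₀ w₃ t z) w₀ = -(herm z z) / 2 - Complex.I * t := by
      simp only [Qhat, herm_add_left, herm_sub_left, herm_smul_left, h₀, h₃₀, hz0]
      linear_combination (herm z z) / 2 * hI
    constructor
    · rw [← herm_conj (Qhat w₀ w₃ t z) w₀, e]
      simp only [map_sub, map_neg, map_mul, map_div₀, Complex.conj_I, Complex.conj_ofReal,
        herm_conj, h2]
      linear_combination -(t : ℂ) * hI
    · rw [Pmap, e]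
      ext j
      simp only [Qhat, Pi.add_apply, Pi.sub_apply, Pi.smul_apply, smul_eq_mul]
      linear_combination (t : ℂ) * w₃ j * hI
  · intro w hw hw3
    have h3w : herm w₃ w = -Complex.I := by rw [← herm_conj, hw3, Complex.conj_I]
    have him : (Complex.I / 2 * (herm w w₀ - herm w₀ w)).im = 0 := by
      rw [← Complex.conj_eq_iff_im]
      simp only [map_sub, map_mul, map_div₀, Complex.conj_I, herm_conj, h2]
      ring
    have hre : (((Complex.I / 2 * (herm w w₀ - herm w₀ w)).re : ℝ) : ℂ)
        = Complex.I / 2 * (herm w w₀ - herm w₀ w) := by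
      apply Complex.ext
      · simp only [Complex.ofReal_re]
      · rw [Complex.ofReal_im, him]
    have hP0 : herm (Pmap w₀ w₃ w) w₀ = 0 := by
      simp only [Pmap, herm_sub_left, herm_smul_left, h₀, h₃₀]
      linear_combination (herm w w₀) * hI
    have hP3 : herm (Pmap w₀ w₃ w) w₃ = 0 := by
      simp only [Pmap, herm_sub_left, herm_smul_left, h₀₃, h₃, hw3]
      ring
    have hPP : herm (Pmap w₀ w₃ w) (Pmap w₀ w₃ w) = -herm w₀ w - herm w w₀ := by
      conv_lhs => arg 2; rw [Pmap]
      rw [herm_sub_right, herm_sub_right, herm_smul_right, hP0, hP3]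
      simp only [Pmap, herm_sub_left, herm_smul_left, hw, h3w]
      linear_combination (herm w w₀) * hI
    refine ⟨him, hP0, hP3, ?_⟩
    rw [Qhat, hre, hPP]
    ext j
    simp only [Pmap, Pi.add_apply, Pi.sub_apply, Pi.smul_apply, smul_eq_mul]
    ring
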